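/- Let q₂, q₃ ∈ ℝ² with q₂ × q₃ ≠ 0, let T ∈ (0, 1), and let r(t) = a₁t² + a₂t be the quadratic curve with a₁ = (q₂ − q₃T)/(T² − T) and a₂ = q₃ − a₁ (so that r(0) = 0, r(T) = q₂, r(1) = q₃). Then the bending energy of r over the whole real line equals E = ∫_ℝ κ(t)² dt = (3π/4) · |q₂ − q₃T|⁴ / (|q₂ × q₃|³ · (T − T²)). -/

import Mathlib

open Real MeasureTheory

/-- An antiderivative of `((1 + w ^ 2) ^ 3)⁻¹`. -/
lemma hasDerivAt_antideriv_inv_one_add_sq_cubed (w : ℝ) :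
    HasDerivAt (fun w : ℝ => w / (4 * (1 + w ^ 2) ^ 2) + 3 / 8 * (w / (1 + w ^ 2))
      + 3 / 8 * arctan w) ((1 + w ^ 2) ^ 3)⁻¹ w := by
  have hpos : (1 + w ^ 2) ≠ 0 := by positivity
  have hsq : HasDerivAt (fun w : ℝ => 1 + w ^ 2) (2 * w) w := by
    simpa using (hasDerivAt_pow 2 w).const_add 1
  have h₁ := (hasDerivAt_id w).fun_div ((hsq.fun_pow 2).const_mul 4) (by positivity)
  have h₂ := ((hasDerivAt_id w).fun_div hsq hpos).const_mul (3 / 8)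
  have h₃ := (hasDerivAt_arctan w).const_mul (3 / 8)
  refine ((h₁.fun_add h₂).fun_add h₃).congr_deriv ?_
  simp only [id]
  field_simp
  ring

lemma integrable_inv_one_add_sq_cubed :
    Integrable fun w : ℝ => ((1 + w ^ 2) ^ 3)⁻¹ := by
  refine integrable_inv_one_add_sq.mono' ?_ (.of_forall fun w => ?_)
  · exact (Continuous.inv₀ (by fun_prop) fun w => by positivity).aestronglyMeasurable
  · rw [Real.norm_of_nonneg (by positivity)]
    gcongr
    exact le_self_pow₀ (by nlinarith [sq_nonneg w]) (by norm_num)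

lemma abs_div_one_add_sq_le (w : ℝ) : |w / (1 + w ^ 2)| ≤ |w⁻¹| := by
  rcases eq_or_ne w 0 with rfl | hw
  · simp
  · have hpos : 0 < |w| := abs_pos.mpr hw
    rw [abs_div, abs_inv, abs_of_pos (by positivity : 0 < 1 + w ^ 2), ← sq_abs w,
      div_le_iff₀ (by positivity)]
    field_simp
    linarith

lemma abs_div_one_add_sq_sq_le (w : ℝ) : |w / (4 * (1 + w ^ 2) ^ 2)| ≤ |w⁻¹| := by
  refine le_trans ?_ (abs_div_one_add_sq_le w)
  rw [abs_div, abs_div, abs_of_pos (by positivity : 0 < 1 + w ^ 2),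
    abs_of_pos (by positivity : 0 < 4 * (1 + w ^ 2) ^ 2)]
  gcongr
  nlinarith [sq_nonneg w, sq_nonneg (w ^ 2)]

lemma integral_inv_one_add_sq_cubed : ∫ w : ℝ, ((1 + w ^ 2) ^ 3)⁻¹ = 3 * π / 8 := by
  have key : ∀ (l : Filter ℝ) (c : ℝ), Filter.Tendsto (fun w : ℝ => w⁻¹) l (nhds 0) →
      Filter.Tendsto arctan l (nhds c) →
      Filter.Tendsto (fun w : ℝ => w / (4 * (1 + w ^ 2) ^ 2) + 3 / 8 * (w / (1 + w ^ 2))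
        + 3 / 8 * arctan w) l (nhds (0 + 3 / 8 * 0 + 3 / 8 * c)) := by
    intro l c hl hc
    have habs : Filter.Tendsto (fun w : ℝ => |w⁻¹|) l (nhds 0) := by simpa using hl.abs
    exact ((squeeze_zero_norm abs_div_one_add_sq_sq_le habs).add
      ((squeeze_zero_norm abs_div_one_add_sq_le habs).const_mul _)).add (hc.const_mul _)
  rw [integral_of_hasDerivAt_of_tendsto hasDerivAt_antideriv_inv_one_add_sq_cubed
    integrable_inv_one_add_sq_cubed
    (key _ _ tendsto_inv_atBot_zero (tendsto_arctan_atBot.mono_right nhdsWithin_le_nhds))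
    (key _ _ tendsto_inv_atTop_zero (tendsto_arctan_atTop.mono_right nhdsWithin_le_nhds))]
  ring

lemma deriv_quadratic (a b : ℝ) :
    deriv (fun t : ℝ => a * t ^ 2 + b * t) = fun t => 2 * a * t + b := by
  funext t
  have h := ((hasDerivAt_pow 2 t).const_mul a).fun_add ((hasDerivAt_id' t).const_mul b)
  rw [h.deriv]
  norm_num
  ring

lemma deriv_affine (a b : ℝ) : deriv (fun t : ℝ => 2 * a * t + b) = fun _ => 2 * a := by
  funext t
  have h := ((hasDerivAt_id' t).const_mul (2 * a)).add_const b
  rw [h.deriv]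
  ring

/-- The total bending energy of a parabola with velocity `t ↦ 2 t (a, b) + (c, d)`. -/
lemma integral_sq_curvature_quadratic (a b c d : ℝ) (hD : a * d - b * c ≠ 0) :
    ∫ t : ℝ, (((2 * a * t + c) * (2 * b) - (2 * b * t + d) * (2 * a)) /
        ((2 * a * t + c) ^ 2 + (2 * b * t + d) ^ 2) ^ ((3 : ℝ) / 2)) ^ 2 =
      3 * π / 4 * (a ^ 2 + b ^ 2) ^ 2 / |a * d - b * c| ^ 3 := by
  have hA : 0 < a ^ 2 + b ^ 2 := by
    by_contra h
    have ha : a = 0 := by nlinarith [sq_nonneg a, sq_nonneg b]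
    have hb : b = 0 := by nlinarith [sq_nonneg a, sq_nonneg b]
    simp [ha, hb] at hD
  set A := a ^ 2 + b ^ 2 with hAdef
  set E := |a * d - b * c| with hEdef
  have hE : 0 < E := abs_pos.mpr hD
  have hE2 : E ^ 2 = (a * d - b * c) ^ 2 := sq_abs _
  have hpoint : ∀ t : ℝ, (((2 * a * t + c) * (2 * b) - (2 * b * t + d) * (2 * a)) /
        ((2 * a * t + c) ^ 2 + (2 * b * t + d) ^ 2) ^ ((3 : ℝ) / 2)) ^ 2 =
      4 * A ^ 3 / E ^ 4 *
        ((1 + (2 * A / E * (t + (a * c + b * d) / (2 * A))) ^ 2) ^ 3)⁻¹ := by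
    intro t
    have hspeed : (2 * a * t + c) ^ 2 + (2 * b * t + d) ^ 2 =
        E ^ 2 / A * (1 + (2 * A / E * (t + (a * c + b * d) / (2 * A))) ^ 2) := by
      field_simp
      rw [hE2, hAdef]
      ring
    have hnum : ((2 * a * t + c) * (2 * b) - (2 * b * t + d) * (2 * a)) ^ 2 = 4 * E ^ 2 := by
      rw [hE2]
      ring
    rw [div_pow, hnum, ← Real.rpow_mul_natCast (by positivity),
      show (3 : ℝ) / 2 * (2 : ℕ) = (3 : ℕ) by norm_num, Real.rpow_natCast, hspeed, mul_pow]
    have hW : 1 + (2 * A / E * (t + (a * c + b * d) / (2 * A))) ^ 2 ≠ 0 := by positivity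
    generalize 1 + (2 * A / E * (t + (a * c + b * d) / (2 * A))) ^ 2 = W at hW
    field_simp
  simp_rw [hpoint]
  rw [integral_const_mul,
    integral_add_right_eq_self (fun t : ℝ => ((1 + (2 * A / E * t) ^ 2) ^ 3)⁻¹),
    Measure.integral_comp_mul_left (fun w : ℝ => ((1 + w ^ 2) ^ 3)⁻¹),
    integral_inv_one_add_sq_cubed, abs_of_pos (by positivity), smul_eq_mul]
  field_simp
  norm_num

/-- For `q₂, q₃ ∈ ℝ²` with `q₂ × q₃ ≠ 0` and `T ∈ (0,1)`, the quadratic curve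
`r(t) = a₁ t² + a₂ t` with `a₁ = (q₂ − q₃ T)/(T² − T)`, `a₂ = q₃ − a₁`
(so `r(0) = 0`, `r(T) = q₂`, `r(1) = q₃`) has bending energy over the whole
real line equal to `(3π/4) · |q₂ − q₃T|⁴ / (|q₂ × q₃|³ · (T − T²))`. -/
theorem energy_of_interpolating_quadratic
    (q₂ q₃ : ℝ × ℝ)
    (hcross : q₂.1 * q₃.2 - q₂.2 * q₃.1 ≠ 0)
    (T : ℝ) (hT : T ∈ Set.Ioo (0 : ℝ) 1)
    (a₁ a₂ : ℝ × ℝ)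
    (ha₁ : a₁ = (T ^ 2 - T)⁻¹ • (q₂ - T • q₃))
    (ha₂ : a₂ = q₃ - a₁)
    (x y : ℝ → ℝ)
    (hx : x = fun t => a₁.1 * t ^ 2 + a₂.1 * t)
    (hy : y = fun t => a₁.2 * t ^ 2 + a₂.2 * t)
    (κ : ℝ → ℝ)
    (hκ : κ = fun t =>
      (deriv x t * deriv (deriv y) t - deriv y t * deriv (deriv x) t) /
        ((deriv x t) ^ 2 + (deriv y t) ^ 2) ^ ((3 : ℝ) / 2)) :
    ∫ t : ℝ, (κ t) ^ 2 =
      (3 * π / 4) * (Real.sqrt ((q₂.1 - T * q₃.1) ^ 2 + (q₂.2 - T * q₃.2) ^ 2)) ^ 4 /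
        (|q₂.1 * q₃.2 - q₂.2 * q₃.1| ^ 3 * (T - T ^ 2)) := by
  have hS : 0 < T - T ^ 2 := by nlinarith [hT.1, hT.2]
  have hS' : T ^ 2 - T ≠ 0 := by linarith
  have hcross_coeff : a₁.1 * a₂.2 - a₁.2 * a₂.1 =
      (q₂.1 * q₃.2 - q₂.2 * q₃.1) / (T ^ 2 - T) := by
    simp only [ha₂, ha₁, Prod.fst_sub, Prod.snd_sub, Prod.smul_fst, Prod.smul_snd, smul_eq_mul]
    field_simp
    ring
  have hnorm : a₁.1 ^ 2 + a₁.2 ^ 2 =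
      ((q₂.1 - T * q₃.1) ^ 2 + (q₂.2 - T * q₃.2) ^ 2) / (T - T ^ 2) ^ 2 := by
    simp only [ha₁, Prod.fst_sub, Prod.snd_sub, Prod.smul_fst, Prod.smul_snd, smul_eq_mul]
    rw [show (T - T ^ 2) ^ 2 = (T ^ 2 - T) ^ 2 by ring]
    field_simp
  simp only [hκ, hx, hy, deriv_quadratic, deriv_affine]
  rw [integral_sq_curvature_quadratic _ _ _ _
      (by rw [hcross_coeff]; exact div_ne_zero hcross hS'),
    hcross_coeff, hnorm, abs_div, abs_sub_comm (T ^ 2), abs_of_pos hS,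
    show ∀ z : ℝ, √z ^ 4 = (√z ^ 2) ^ 2 from fun z => by ring, Real.sq_sqrt (by positivity)]
  have hX : |q₂.1 * q₃.2 - q₂.2 * q₃.1| ≠ 0 := abs_ne_zero.mpr hcross
  generalize |q₂.1 * q₃.2 - q₂.2 * q₃.1| = X at hX ⊢
  generalize T - T ^ 2 = S at hS ⊢
  field_simp
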